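/- Let L be a pseudo-Finsler Lagrangian on Ω with spray nonlinear connection N and nonlinear curvature R^μ{}_{αβ}. Let U ⊆ ℝ^m be open and let s : U → ℝ^m be smooth with (x,s(x)) ∈ Ω for all x ∈ U, and suppose s is pregeodesic: D_s s = f·s for some smooth f : U → ℝ. Then at every x ∈ U and for every X ∈ ℝ^m: (a) R_s(X)^λ := R^λ{}_{βμ}(x,s(x)) X^β s^μ(x) equals the Riemann curvature of the pullback metric applied as R^{g_s}(X,s)s, i.e. R^λ{}_{βμ}(x,s(x)) X^β s^μ = R^{g_s}{}^λ{}_{νμρ}(x) s^ν X^μ s^ρ; and (b) the Finsler Ricci scalar satisfies Ric(s(x)) = (Ric^{g_s})_{νρ}(x) s^ν(x) s^ρ(x). -/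

import Mathlib

open scoped BigOperators

noncomputable section

/-- `Vec m` is the model space `ℝ^m`. -/
abbrev Vec (m : ℕ) : Type := Fin m → ℝ

variable {m : ℕ}

/-- Partial derivative in the velocity (second) variable: `∂f/∂v^i (x,v)`. -/
def pdv (f : Vec m → Vec m → ℝ) (i : Fin m) (x v : Vec m) : ℝ :=
  fderiv ℝ (f x) v (Pi.single i 1)

/-- Partial derivative in the position (first) variable: `∂f/∂x^i (x,v)`. -/
def pdx (f : Vec m → Vec m → ℝ) (i : Fin m) (x v : Vec m) : ℝ :=
  fderiv ℝ (fun y => f y v) x (Pi.single i 1)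

/-- Vertical Hessian `g_{αβ}(x,v) = ∂²L/∂v^α∂v^β` of the Lagrangian. -/
def gmet (L : Vec m → Vec m → ℝ) (x v : Vec m) : Matrix (Fin m) (Fin m) ℝ :=
  Matrix.of fun α β => pdv (pdv L β) α x v

/-- Inverse metric `g^{αβ}` (nonsingular matrix inverse). -/
def ginv (L : Vec m → Vec m → ℝ) (x v : Vec m) : Matrix (Fin m) (Fin m) ℝ :=
  (gmet L x v)⁻¹

/-- Geodesic spray coefficients
`G^α = (1/4) g^{αδ}(∂g_{δγ}/∂x^β + ∂g_{δβ}/∂x^γ − ∂g_{βγ}/∂x^δ) v^β v^γ`. -/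
def spray (L : Vec m → Vec m → ℝ) (α : Fin m) (x v : Vec m) : ℝ :=
  (1/4) * ∑ δ, ginv L x v α δ *
    (∑ β, ∑ γ,
      (pdx (fun y w => gmet L y w δ γ) β x v
        + pdx (fun y w => gmet L y w δ β) γ x v
        - pdx (fun y w => gmet L y w β γ) δ x v) * v β * v γ)

/-- The spray nonlinear connection `N^α_μ = ∂G^α/∂v^μ`. -/
def nConn (L : Vec m → Vec m → ℝ) (α μ : Fin m) (x v : Vec m) : ℝ :=
  pdv (spray L α) μ x v

/-- Horizontal derivative `δ_μ f = ∂f/∂x^μ − N^ν_μ ∂f/∂v^ν` for a nonlinear connection `N`. -/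
def hderiv (N : Fin m → Fin m → Vec m → Vec m → ℝ) (f : Vec m → Vec m → ℝ)
    (μ : Fin m) (x v : Vec m) : ℝ :=
  pdx f μ x v - ∑ ν, N ν μ x v * pdv f ν x v

/-- Curvature of the nonlinear connection: `R^μ_{αβ} = δ_α N^μ_β − δ_β N^μ_α`. -/
def curv (N : Fin m → Fin m → Vec m → Vec m → ℝ) (μ α β : Fin m) (x v : Vec m) : ℝ :=
  hderiv N (N μ β) α x v - hderiv N (N μ α) β x v

/-- Ricci scalar `Ric(v) = R^μ{}_{μα} v^α`. -/
def ricciScalar (N : Fin m → Fin m → Vec m → Vec m → ℝ) (x v : Vec m) : ℝ :=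
  ∑ α, (∑ μ, curv N μ μ α x v) * v α

/-- Ricci 1-form component `(Ric_v)_α = R^μ{}_{μα}`. -/
def ricciOne (N : Fin m → Fin m → Vec m → Vec m → ℝ) (α : Fin m) (x v : Vec m) : ℝ :=
  ∑ μ, curv N μ μ α x v

/-- `χ_α := (∂R^γ{}_{αν}/∂v^γ) v^ν`. -/
def chiForm (N : Fin m → Fin m → Vec m → Vec m → ℝ) (α : Fin m) (x v : Vec m) : ℝ :=
  ∑ γ, ∑ ν, pdv (curv N γ α ν) γ x v * v ν

/-- Partial derivative `∂u^α/∂x^μ` of a vector field on the base. -/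
def pde (u : Vec m → Vec m) (α μ : Fin m) (x : Vec m) : ℝ :=
  fderiv ℝ (fun y => u y α) x (Pi.single μ 1)

/-- Covariant derivative `(D_X u)^α = (∂u^α/∂x^μ + N^α_μ(x,u(x))) X^μ`. -/
def covD (L : Vec m → Vec m → ℝ) (u X : Vec m → Vec m) (x : Vec m) : Vec m :=
  fun α => ∑ μ, (pde u α μ x + nConn L α μ x (u x)) * X x μ

/-- Flipped derivative `(D̃_u X)^α = (∂X^α/∂x^μ) u^μ + N^α_μ(x,u(x)) X^μ`. -/
def flipD (L : Vec m → Vec m → ℝ) (u X : Vec m → Vec m) (x : Vec m) : Vec m :=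
  fun α => (∑ μ, pde X α μ x * u x μ) + ∑ μ, nConn L α μ x (u x) * X x μ

/-- Lie bracket `[X,Y]^α = X^μ ∂Y^α/∂x^μ − Y^μ ∂X^α/∂x^μ`. -/
def lieB (X Y : Vec m → Vec m) (x : Vec m) : Vec m :=
  fun α => ∑ μ, (X x μ * pde Y α μ x - Y x μ * pde X α μ x)

/-- Scalar product `g_u(X,Y)(x) = g_{αβ}(x,u(x)) X^α Y^β`. -/
def gProd (L : Vec m → Vec m → ℝ) (u X Y : Vec m → Vec m) (x : Vec m) : ℝ :=
  ∑ α, ∑ β, gmet L x (u x) α β * X x α * Y x β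

/-- Directional derivative `∂_X f = X^μ ∂f/∂x^μ`. -/
def dirD (X : Vec m → Vec m) (f : Vec m → ℝ) (x : Vec m) : ℝ :=
  ∑ μ, X x μ * fderiv ℝ f x (Pi.single μ 1)


/-- Derivative `∂(g_s)_{αβ}/∂x^μ` of an `x`-dependent metric. -/
def pdm (gs : Vec m → Matrix (Fin m) (Fin m) ℝ) (α β μ : Fin m) (x : Vec m) : ℝ :=
  fderiv ℝ (fun y => gs y α β) x (Pi.single μ 1)

/-- Christoffel symbols `γ^λ_{μν}` of the metric `gs`. -/
def christ (gs : Vec m → Matrix (Fin m) (Fin m) ℝ) (lam μ ν : Fin m) (x : Vec m) : ℝ :=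
  (1/2) * ∑ σ, (gs x)⁻¹ lam σ * (pdm gs σ ν μ x + pdm gs σ μ ν x - pdm gs μ ν σ x)

/-- Levi-Civita covariant derivative `(∇_X Y)^λ = X^μ ∂Y^λ/∂x^μ + γ^λ_{νμ} Y^ν X^μ`. -/
def lcCov (gs : Vec m → Matrix (Fin m) (Fin m) ℝ) (X Y : Vec m → Vec m) (x : Vec m) : Vec m :=
  fun lam => (∑ μ, X x μ * pde Y lam μ x) + ∑ μ, ∑ ν, christ gs lam ν μ x * Y x ν * X x μ

/-- Riemann curvature `R^λ{}_{νμρ}` of the metric `gs`. -/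
def riem (gs : Vec m → Matrix (Fin m) (Fin m) ℝ) (lam ν μ ρ : Fin m) (x : Vec m) : ℝ :=
  fderiv ℝ (fun y => christ gs lam ν ρ y) x (Pi.single μ 1)
  - fderiv ℝ (fun y => christ gs lam ν μ y) x (Pi.single ρ 1)
  + (∑ σ, christ gs lam σ μ x * christ gs σ ν ρ x)
  - ∑ σ, christ gs lam σ ρ x * christ gs σ ν μ x

/-- Ricci tensor of the metric `gs`. -/
def ricciPull (gs : Vec m → Matrix (Fin m) (Fin m) ℝ) (ν ρ : Fin m) (x : Vec m) : ℝ :=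
  ∑ lam, riem gs lam ν lam ρ x


/-- Joint smoothness on `Ω`. -/
def SM (Ω : Set (Vec m × Vec m)) (F : Vec m → Vec m → ℝ) : Prop :=
  ContDiffOn ℝ (⊤ : ℕ∞) (fun p : Vec m × Vec m => F p.1 p.2) Ω

/-- Positive homogeneity of degree `k` on `Ω`. -/
def HM (Ω : Set (Vec m × Vec m)) (k : ℕ) (F : Vec m → Vec m → ℝ) : Prop :=
  ∀ p ∈ Ω, ∀ t : ℝ, 0 < t → F p.1 (t • p.2) = t ^ k * F p.1 p.2

lemma aux_fderiv_apply_smooth {E : Type*} [NormedAddCommGroup E] [NormedSpace ℝ E]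
    {S : Set E} (hS : IsOpen S) {φ : E → ℝ} (hφ : ContDiffOn ℝ (⊤ : ℕ∞) φ S) (w : E) :
    ContDiffOn ℝ (⊤ : ℕ∞) (fun q => fderiv ℝ φ q w) S :=
  (hφ.fderiv_of_isOpen hS (m := (⊤ : ℕ∞)) (by simp)).clm_apply contDiffOn_const

lemma aux_diffAt {E : Type*} [NormedAddCommGroup E] [NormedSpace ℝ E]
    {S : Set E} (hS : IsOpen S) {φ : E → ℝ} (hφ : ContDiffOn ℝ (⊤ : ℕ∞) φ S) {p : E}
    (hp : p ∈ S) : DifferentiableAt ℝ φ p :=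
  (hφ.contDiffAt (hS.mem_nhds hp)).differentiableAt (by simp)

lemma aux_symm {E : Type*} [NormedAddCommGroup E] [NormedSpace ℝ E]
    {S : Set E} (hS : IsOpen S) {φ : E → ℝ} (hφ : ContDiffOn ℝ (⊤ : ℕ∞) φ S) {p : E}
    (hp : p ∈ S) (u w : E) :
    fderiv ℝ (fun q => fderiv ℝ φ q w) p u = fderiv ℝ (fun q => fderiv ℝ φ q u) p w := by
  have h1 : DifferentiableAt ℝ (fderiv ℝ φ) p :=
    ((hφ.fderiv_of_isOpen hS (m := (⊤ : ℕ∞)) (by simp)).contDiffAt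
      (hS.mem_nhds hp)).differentiableAt (by simp)
  have h2 : ∀ a : E, fderiv ℝ (fun q => fderiv ℝ φ q a) p
      = (fderiv ℝ (fderiv ℝ φ) p).flip a := by
    intro a
    have := (h1.hasFDerivAt.clm_apply (hasFDerivAt_const a p)).fderiv
    rw [this]; ext z; simp
  rw [h2, h2]
  exact (hφ.contDiffAt (hS.mem_nhds hp)).isSymmSndFDerivAt
    (by rw [minSmoothness_of_isRCLikeNormedField]; exact WithTop.coe_le_coe.2 le_top) u w

section calcRules
variable {Ω : Set (Vec m × Vec m)} {F H : Vec m → Vec m → ℝ}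

lemma hasFDeriv_v (hΩ : IsOpen Ω) (hF : SM Ω F) {x v : Vec m} (hp : (x, v) ∈ Ω) :
    HasFDerivAt (F x) ((fderiv ℝ (fun p : Vec m × Vec m => F p.1 p.2) (x, v)).comp
      (ContinuousLinearMap.inr ℝ (Vec m) (Vec m))) v :=
  HasFDerivAt.comp (g := fun p : Vec m × Vec m => F p.1 p.2) v
    (aux_diffAt hΩ hF hp).hasFDerivAt (hasFDerivAt_prodMk_right x v)

lemma hasFDeriv_x (hΩ : IsOpen Ω) (hF : SM Ω F) {x v : Vec m} (hp : (x, v) ∈ Ω) :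
    HasFDerivAt (fun y => F y v) ((fderiv ℝ (fun p : Vec m × Vec m => F p.1 p.2) (x, v)).comp
      (ContinuousLinearMap.inl ℝ (Vec m) (Vec m))) x :=
  HasFDerivAt.comp (f := fun y => (y, v)) (g := fun p : Vec m × Vec m => F p.1 p.2) x
    (aux_diffAt hΩ hF hp).hasFDerivAt (hasFDerivAt_prodMk_left x v)

lemma pdv_eq (hΩ : IsOpen Ω) (hF : SM Ω F) (i : Fin m) {x v : Vec m} (hp : (x, v) ∈ Ω) :
    pdv F i x v = fderiv ℝ (fun p : Vec m × Vec m => F p.1 p.2) (x, v) (0, Pi.single i 1) := by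
  unfold pdv; rw [(hasFDeriv_v hΩ hF hp).fderiv]; simp

lemma pdx_eq (hΩ : IsOpen Ω) (hF : SM Ω F) (i : Fin m) {x v : Vec m} (hp : (x, v) ∈ Ω) :
    pdx F i x v = fderiv ℝ (fun p : Vec m × Vec m => F p.1 p.2) (x, v) (Pi.single i 1, 0) := by
  unfold pdx; rw [(hasFDeriv_x hΩ hF hp).fderiv]; simp

lemma SM.pdv (hΩ : IsOpen Ω) (hF : SM Ω F) (i : Fin m) : SM Ω (pdv F i) :=
  (aux_fderiv_apply_smooth hΩ hF (0, Pi.single i 1)).congr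
    fun p hp => pdv_eq hΩ hF i (x := p.1) (v := p.2) hp

lemma SM.pdx (hΩ : IsOpen Ω) (hF : SM Ω F) (i : Fin m) : SM Ω (pdx F i) :=
  (aux_fderiv_apply_smooth hΩ hF (Pi.single i 1, 0)).congr
    fun p hp => pdx_eq hΩ hF i (x := p.1) (v := p.2) hp

lemma pd_congr (hΩ : IsOpen Ω) {φ ψ : Vec m × Vec m → ℝ} (h : ∀ p ∈ Ω, φ p = ψ p)
    {p : Vec m × Vec m} (hp : p ∈ Ω) : fderiv ℝ φ p = fderiv ℝ ψ p :=
  Filter.EventuallyEq.fderiv_eq (Filter.eventuallyEq_of_mem (hΩ.mem_nhds hp) h)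

lemma pdv_congr (hΩ : IsOpen Ω) (h : ∀ p ∈ Ω, F p.1 p.2 = H p.1 p.2) (i : Fin m)
    {x v : Vec m} (hp : (x, v) ∈ Ω) : pdv F i x v = pdv H i x v := by
  unfold pdv
  have : F x =ᶠ[nhds v] H x := by
    have h2 : Filter.Tendsto (fun w : Vec m => (x, w)) (nhds v) (nhds (x, v)) :=
      (Continuous.prodMk_right x).tendsto v
    filter_upwards [h2 (hΩ.mem_nhds hp)] with w hw using h _ hw
  rw [this.fderiv_eq]

lemma pdx_congr (hΩ : IsOpen Ω) (h : ∀ p ∈ Ω, F p.1 p.2 = H p.1 p.2) (i : Fin m)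
    {x v : Vec m} (hp : (x, v) ∈ Ω) : pdx F i x v = pdx H i x v := by
  unfold pdx
  have : (fun y => F y v) =ᶠ[nhds x] (fun y => H y v) := by
    have h2 : Filter.Tendsto (fun w : Vec m => (w, v)) (nhds x) (nhds (x, v)) :=
      (Continuous.prodMk_left v).tendsto x
    filter_upwards [h2 (hΩ.mem_nhds hp)] with w hw using h _ hw
  rw [this.fderiv_eq]

lemma pdv_pdv_comm (hΩ : IsOpen Ω) (hF : SM Ω F) (i j : Fin m) {x v : Vec m}
    (hp : (x, v) ∈ Ω) : pdv (pdv F i) j x v = pdv (pdv F j) i x v := by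
  rw [pdv_eq hΩ (hF.pdv hΩ i) j hp, pdv_eq hΩ (hF.pdv hΩ j) i hp,
    pd_congr hΩ (fun p hp => pdv_eq hΩ hF i (x := p.1) (v := p.2) hp) hp,
    pd_congr hΩ (fun p hp => pdv_eq hΩ hF j (x := p.1) (v := p.2) hp) hp]
  exact aux_symm hΩ hF hp _ _

lemma pdx_pdv_comm (hΩ : IsOpen Ω) (hF : SM Ω F) (i j : Fin m) {x v : Vec m}
    (hp : (x, v) ∈ Ω) : pdv (pdx F i) j x v = pdx (pdv F j) i x v := by
  rw [pdv_eq hΩ (hF.pdx hΩ i) j hp, pdx_eq hΩ (hF.pdv hΩ j) i hp,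
    pd_congr hΩ (fun p hp => pdx_eq hΩ hF i (x := p.1) (v := p.2) hp) hp,
    pd_congr hΩ (fun p hp => pdv_eq hΩ hF j (x := p.1) (v := p.2) hp) hp]
  exact aux_symm hΩ hF hp _ _

lemma SM.mul (hF : SM Ω F) (hH : SM Ω H) : SM Ω (fun x v => F x v * H x v) :=
  ContDiffOn.mul hF hH
lemma SM.add (hF : SM Ω F) (hH : SM Ω H) : SM Ω (fun x v => F x v + H x v) :=
  ContDiffOn.add hF hH
lemma SM.sub (hF : SM Ω F) (hH : SM Ω H) : SM Ω (fun x v => F x v - H x v) :=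
  ContDiffOn.sub hF hH
lemma SM.sum {ι : Type*} [Fintype ι] {K : ι → Vec m → Vec m → ℝ} (h : ∀ i, SM Ω (K i)) :
    SM Ω (fun x v => ∑ i, K i x v) :=
  ContDiffOn.sum (fun i _ => h i)
lemma SM.const (c : ℝ) : SM Ω (fun _ _ => c) := contDiffOn_const
lemma SM.coord (i : Fin m) : SM Ω (fun _ v => v i) := by
  unfold SM; fun_prop

lemma pdv_mul (hΩ : IsOpen Ω) (hF : SM Ω F) (hH : SM Ω H) (i : Fin m) {x v : Vec m}
    (hp : (x, v) ∈ Ω) : pdv (fun x v => F x v * H x v) i x v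
      = pdv F i x v * H x v + F x v * pdv H i x v := by
  unfold pdv
  have := ((hasFDeriv_v hΩ hF hp).differentiableAt.hasFDerivAt.mul
    (hasFDeriv_v hΩ hH hp).differentiableAt.hasFDerivAt).fderiv
  show fderiv ℝ (F x * H x) v _ = _
  rw [this]; simp; ring
lemma pdv_add (hΩ : IsOpen Ω) (hF : SM Ω F) (hH : SM Ω H) (i : Fin m) {x v : Vec m}
    (hp : (x, v) ∈ Ω) : pdv (fun x v => F x v + H x v) i x v = pdv F i x v + pdv H i x v := by
  unfold pdv
  have := ((hasFDeriv_v hΩ hF hp).differentiableAt.hasFDerivAt.add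
    (hasFDeriv_v hΩ hH hp).differentiableAt.hasFDerivAt).fderiv
  show fderiv ℝ (F x + H x) v _ = _
  rw [this]; simp
lemma pdv_sub (hΩ : IsOpen Ω) (hF : SM Ω F) (hH : SM Ω H) (i : Fin m) {x v : Vec m}
    (hp : (x, v) ∈ Ω) : pdv (fun x v => F x v - H x v) i x v = pdv F i x v - pdv H i x v := by
  unfold pdv
  have := ((hasFDeriv_v hΩ hF hp).differentiableAt.hasFDerivAt.sub
    (hasFDeriv_v hΩ hH hp).differentiableAt.hasFDerivAt).fderiv
  show fderiv ℝ (F x - H x) v _ = _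
  rw [this]; simp
lemma pdv_sum {ι : Type*} [Fintype ι] (hΩ : IsOpen Ω) {K : ι → Vec m → Vec m → ℝ}
    (h : ∀ i, SM Ω (K i)) (i : Fin m) {x v : Vec m}
    (hp : (x, v) ∈ Ω) : pdv (fun x v => ∑ j, K j x v) i x v = ∑ j, pdv (K j) i x v := by
  unfold pdv
  have := (HasFDerivAt.fun_sum (u := Finset.univ) (fun j _ =>
    (hasFDeriv_v hΩ (h j) hp).differentiableAt.hasFDerivAt)).fderiv
  rw [this]; simp
lemma pdv_const (c : ℝ) (i : Fin m) (x v : Vec m) : pdv (fun _ _ => c) i x v = 0 := by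
  simp [pdv]
lemma pdv_coord (i j : Fin m) (x v : Vec m) :
    pdv (fun _ v => v i) j x v = if i = j then 1 else 0 := by
  unfold pdv
  have := (hasFDerivAt_apply (𝕜 := ℝ) i v).fderiv
  rw [this]; simp [Pi.single_apply]

/-- expansion of a linear functional on coordinates -/
lemma clm_expand (A : Vec m →L[ℝ] ℝ) (v : Vec m) : A v = ∑ i, A (Pi.single i 1) * v i := by
  conv_lhs => rw [pi_eq_sum_univ' v]
  rw [map_sum]
  refine Finset.sum_congr rfl fun i _ => ?_
  rw [map_smul, smul_eq_mul, mul_comm]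

lemma euler (hΩ : IsOpen Ω) (hF : SM Ω F) {k : ℕ} (hk : HM Ω k F) {x v : Vec m}
    (hp : (x, v) ∈ Ω) : ∑ i, pdv F i x v * v i = k * F x v := by
  have h1 : HasDerivAt (fun t : ℝ => F x (t • v)) (fderiv ℝ (F x) v v) 1 := by
    have hd : HasFDerivAt (F x) (fderiv ℝ (F x) v) ((1 : ℝ) • v) := by
      rw [one_smul]; exact (hasFDeriv_v hΩ hF hp).differentiableAt.hasFDerivAt
    have h2 : HasDerivAt (fun t : ℝ => t • v) v 1 := by
      simpa using (hasDerivAt_id (1 : ℝ)).smul_const v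
    exact hd.comp_hasDerivAt 1 h2
  have h3 : HasDerivAt (fun t : ℝ => t ^ k * F x v) (k * F x v) 1 := by
    simpa using (hasDerivAt_pow k (1 : ℝ)).mul_const (F x v)
  have h4 : (fun t : ℝ => F x (t • v)) =ᶠ[nhds 1] (fun t : ℝ => t ^ k * F x v) := by
    filter_upwards [lt_mem_nhds (zero_lt_one' ℝ)] with t ht using hk _ hp t ht
  have := h1.unique (h3.congr_of_eventuallyEq h4)
  rw [← this, clm_expand]; rfl

lemma HM.pdx (hΩ : IsOpen Ω) {k : ℕ} (hk : HM Ω k F) (hF : SM Ω F) (i : Fin m) :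
    HM Ω k (pdx F i) := by
  rintro ⟨x, v⟩ hp t ht
  have : (fun y => F y (t • v)) =ᶠ[nhds x] (fun y => t ^ k * F y v) := by
    have h2 : Filter.Tendsto (fun w : Vec m => (w, v)) (nhds x) (nhds (x, v)) :=
      (Continuous.prodMk_left v).tendsto x
    filter_upwards [h2 (hΩ.mem_nhds hp)] with w hw using hk _ hw t ht
  show fderiv ℝ (fun y => F y (t • v)) x _ = _ * fderiv ℝ (fun y => F y v) x _
  rw [this.fderiv_eq, ((hasFDeriv_x hΩ hF hp).differentiableAt.hasFDerivAt.const_mul _).fderiv]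
  simp

lemma HM.pdv (hΩ : IsOpen Ω) (hcone : ∀ p ∈ Ω, ∀ s : ℝ, 0 < s → (p.1, s • p.2) ∈ Ω)
    {k : ℕ} (hk : HM Ω (k + 1) F) (hF : SM Ω F) (i : Fin m) :
    HM Ω k (pdv F i) := by
  rintro ⟨x, v⟩ hp t ht
  have h0 : (fun w => F x (t • w)) =ᶠ[nhds v] (fun w => t ^ (k + 1) * F x w) := by
    have h2 : Filter.Tendsto (fun w : Vec m => (x, w)) (nhds v) (nhds (x, v)) :=
      (Continuous.prodMk_right x).tendsto v
    filter_upwards [h2 (hΩ.mem_nhds hp)] with w hw using hk _ hw t ht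
  have h1 := h0.fderiv_eq (𝕜 := ℝ)
  rw [((hasFDeriv_v hΩ hF hp).differentiableAt.hasFDerivAt.const_mul _).fderiv] at h1
  have h3 : HasFDerivAt (fun w : Vec m => t • w) (t • ContinuousLinearMap.id ℝ (Vec m)) v :=
    (hasFDerivAt_id v).const_smul t
  have h4 :=
    HasFDerivAt.comp (𝕜 := ℝ) (g := F x) (f := fun w : Vec m => t • w) v
      (hasFDeriv_v hΩ hF (hcone _ hp t ht)).differentiableAt.hasFDerivAt h3
  have h4' : fderiv ℝ (fun w => F x (t • w)) v = _ := h4.fderiv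
  rw [h4'] at h1
  have h5 := DFunLike.congr_fun h1 (Pi.single i 1)
  simp at h5
  show fderiv ℝ (F x) (t • v) _ = _ * fderiv ℝ (F x) v _
  have : t ≠ 0 := ht.ne'
  have h6 : t * fderiv ℝ (F x) (t • v) (Pi.single i 1)
      = t * (t ^ k * fderiv ℝ (F x) v (Pi.single i 1)) := by
    rw [h5]; ring
  exact mul_left_cancel₀ this h6

/-- chain rule along a section -/
lemma chain (hΩ : IsOpen Ω) (hF : SM Ω F) {s : Vec m → Vec m} {x : Vec m}
    (hs : DifferentiableAt ℝ s x) (hp : (x, s x) ∈ Ω) (μ : Fin m) :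
    fderiv ℝ (fun y => F y (s y)) x (Pi.single μ 1)
      = pdx F μ x (s x) + ∑ σ, pdv F σ x (s x) * pde s σ μ x := by
  have h1 : HasFDerivAt (fun y => (y, s y))
      ((ContinuousLinearMap.id ℝ (Vec m)).prod (fderiv ℝ s x)) x :=
    (hasFDerivAt_id x).prodMk hs.hasFDerivAt
  have h2 : HasFDerivAt (fun y => F y (s y)) _ x :=
    HasFDerivAt.comp (g := fun p : Vec m × Vec m => F p.1 p.2) x
    (aux_diffAt hΩ hF hp).hasFDerivAt h1
  have h3 : ∀ σ, pde s σ μ x = fderiv ℝ s x (Pi.single μ 1) σ := by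
    intro σ
    unfold pde
    have := (hasFDerivAt_pi'.1 hs.hasFDerivAt σ).fderiv
    rw [this]; simp
  have h5 : ∑ σ, pdv F σ x (s x) * pde s σ μ x
      = fderiv ℝ (fun p : Vec m × Vec m => F p.1 p.2) (x, s x)
        (0, fderiv ℝ s x (Pi.single μ 1)) := by
    have := clm_expand (fderiv ℝ (F x) (s x)) (fderiv ℝ s x (Pi.single μ 1))
    rw [(hasFDeriv_v hΩ hF hp).fderiv] at this
    simp only [ContinuousLinearMap.comp_apply, ContinuousLinearMap.inr_apply] at this
    rw [this]
    refine Finset.sum_congr rfl fun σ _ => ?_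
    rw [h3, pdv_eq hΩ hF σ hp]
  rw [h5, pdx_eq hΩ hF μ hp, h2.fderiv, ← map_add]
  simp

end calcRules

lemma aux_det_smooth {E : Type*} [NormedAddCommGroup E] [NormedSpace ℝ E] {S : Set E}
    {A : E → Matrix (Fin m) (Fin m) ℝ}
    (hA : ∀ i j, ContDiffOn ℝ (⊤ : ℕ∞) (fun q => A q i j) S) :
    ContDiffOn ℝ (⊤ : ℕ∞) (fun q => (A q).det) S := by
  simp only [Matrix.det_apply']
  exact ContDiffOn.sum fun σ _ => contDiffOn_const.mul (contDiffOn_prod fun i _ => hA _ _)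

lemma aux_inv_smooth {E : Type*} [NormedAddCommGroup E] [NormedSpace ℝ E] {S : Set E}
    {A : E → Matrix (Fin m) (Fin m) ℝ}
    (hA : ∀ i j, ContDiffOn ℝ (⊤ : ℕ∞) (fun q => A q i j) S)
    (hu : ∀ q ∈ S, IsUnit (A q).det) (i j : Fin m) :
    ContDiffOn ℝ (⊤ : ℕ∞) (fun q => (A q)⁻¹ i j) S := by
  simp only [Matrix.inv_def, Matrix.smul_apply, Matrix.adjugate_apply, smul_eq_mul,
    Ring.inverse_eq_inv']
  refine ContDiffOn.mul ((aux_det_smooth hA).inv fun q hq => (hu q hq).ne_zero) ?_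
  refine aux_det_smooth fun a b => ?_
  by_cases h : a = j
  · subst h; simp only [Matrix.updateRow_self]; exact contDiffOn_const
  · simp only [Matrix.updateRow_ne h]; exact hA a b

section finsler
variable {Ω : Set (Vec m × Vec m)} {L : Vec m → Vec m → ℝ}

lemma gS (hΩ : IsOpen Ω) (hL : SM Ω L) (a b : Fin m) :
    SM Ω (fun x v => gmet L x v a b) := (hL.pdv hΩ b).pdv hΩ a

lemma gH (hΩ : IsOpen Ω) (hc : ∀ p ∈ Ω, ∀ s : ℝ, 0 < s → (p.1, s • p.2) ∈ Ω)
    (hL : SM Ω L) (hH : HM Ω 2 L) (a b : Fin m) :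
    HM Ω 0 (fun x v => gmet L x v a b) :=
  HM.pdv (F := pdv L b) hΩ hc (HM.pdv hΩ hc hH hL b) (hL.pdv hΩ b) a

lemma g_symm (hΩ : IsOpen Ω) (hL : SM Ω L) (a b : Fin m) {x v : Vec m} (hp : (x, v) ∈ Ω) :
    gmet L x v a b = gmet L x v b a := pdv_pdv_comm hΩ hL b a hp

/-- Cartan tensor (unnormalised). -/
def cart (L : Vec m → Vec m → ℝ) (a b c : Fin m) (x v : Vec m) : ℝ :=
  pdv (fun y w => gmet L y w a b) c x v

/-- Position derivative of the fundamental tensor. -/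
def dg (L : Vec m → Vec m → ℝ) (a b c : Fin m) (x v : Vec m) : ℝ :=
  pdx (fun y w => gmet L y w a b) c x v

lemma cart13 (hΩ : IsOpen Ω) (hL : SM Ω L) (a b c : Fin m) {x v : Vec m} (hp : (x, v) ∈ Ω) :
    cart L a b c x v = cart L c b a x v :=
  pdv_pdv_comm hΩ (hL.pdv hΩ b) a c hp

lemma cart12 (hΩ : IsOpen Ω) (hL : SM Ω L) (a b c : Fin m) {x v : Vec m} (hp : (x, v) ∈ Ω) :
    cart L a b c x v = cart L b a c x v :=
  pdv_congr hΩ (fun p hp => g_symm hΩ hL a b (x := p.1) (v := p.2) hp) c hp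

lemma cart23 (hΩ : IsOpen Ω) (hL : SM Ω L) (a b c : Fin m) {x v : Vec m} (hp : (x, v) ∈ Ω) :
    cart L a b c x v = cart L a c b x v := by
  rw [cart12 hΩ hL a b c hp, cart13 hΩ hL b a c hp, cart12 hΩ hL c a b hp]

lemma dg_symm (hΩ : IsOpen Ω) (hL : SM Ω L) (a b c : Fin m) {x v : Vec m} (hp : (x, v) ∈ Ω) :
    dg L a b c x v = dg L b a c x v :=
  pdx_congr hΩ (fun p hp => g_symm hΩ hL a b (x := p.1) (v := p.2) hp) c hp

lemma dgS (hΩ : IsOpen Ω) (hL : SM Ω L) (a b c : Fin m) : SM Ω (dg L a b c) :=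
  (gS hΩ hL a b).pdx hΩ c

lemma dgH (hΩ : IsOpen Ω) (hc : ∀ p ∈ Ω, ∀ s : ℝ, 0 < s → (p.1, s • p.2) ∈ Ω)
    (hL : SM Ω L) (hH : HM Ω 2 L) (a b c : Fin m) : HM Ω 0 (dg L a b c) :=
  HM.pdx hΩ (gH hΩ hc hL hH a b) (gS hΩ hL a b) c

lemma cart_v3 (hΩ : IsOpen Ω) (hc : ∀ p ∈ Ω, ∀ s : ℝ, 0 < s → (p.1, s • p.2) ∈ Ω)
    (hL : SM Ω L) (hH : HM Ω 2 L) (a b : Fin m) {x v : Vec m} (hp : (x, v) ∈ Ω) :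
    ∑ c, cart L a b c x v * v c = 0 := by
  have := euler hΩ (gS hΩ hL a b) (gH hΩ hc hL hH a b) hp
  simpa [cart] using this

lemma cart_v2 (hΩ : IsOpen Ω) (hc : ∀ p ∈ Ω, ∀ s : ℝ, 0 < s → (p.1, s • p.2) ∈ Ω)
    (hL : SM Ω L) (hH : HM Ω 2 L) (a b : Fin m) {x v : Vec m} (hp : (x, v) ∈ Ω) :
    ∑ c, cart L a c b x v * v c = 0 := by
  rw [← cart_v3 hΩ hc hL hH a b hp]
  exact Finset.sum_congr rfl fun c _ => by rw [cart23 hΩ hL a c b hp]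

lemma pdv_dg23 (hΩ : IsOpen Ω) (hL : SM Ω L) (a b c d : Fin m) {x v : Vec m}
    (hp : (x, v) ∈ Ω) : pdv (dg L a b c) d x v = pdv (dg L a d c) b x v := by
  have h1 : pdv (dg L a b c) d x v = pdx (cart L a b d) c x v :=
    pdx_pdv_comm hΩ (gS hΩ hL a b) c d hp
  have h2 : pdv (dg L a d c) b x v = pdx (cart L a d b) c x v :=
    pdx_pdv_comm hΩ (gS hΩ hL a d) c b hp
  rw [h1, h2]
  exact pdx_congr hΩ (fun p hp => cart23 hΩ hL a b d (x := p.1) (v := p.2) hp) c hp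

lemma pdv_dg_v (hΩ : IsOpen Ω) (hc : ∀ p ∈ Ω, ∀ s : ℝ, 0 < s → (p.1, s • p.2) ∈ Ω)
    (hL : SM Ω L) (hH : HM Ω 2 L) (a c d : Fin m) {x v : Vec m} (hp : (x, v) ∈ Ω) :
    ∑ b, pdv (dg L a b c) d x v * v b = 0 := by
  have := euler hΩ (dgS hΩ hL a d c) (dgH hΩ hc hL hH a d c) hp
  rw [Nat.cast_zero, zero_mul] at this
  rw [← this]
  exact Finset.sum_congr rfl fun b _ => by rw [pdv_dg23 hΩ hL a b c d hp]

/-- The lowered spray (times four). -/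
def lowS (L : Vec m → Vec m → ℝ) (d : Fin m) (x v : Vec m) : ℝ :=
  ∑ b, ∑ c, (dg L d c b x v + dg L d b c x v - dg L b c d x v) * v b * v c

lemma spray_eq (a : Fin m) (x v : Vec m) :
    spray L a x v = (1/4) * ∑ d, ginv L x v a d * lowS L d x v := rfl

lemma lowS_S (hΩ : IsOpen Ω) (hL : SM Ω L) (d : Fin m) : SM Ω (lowS L d) :=
  SM.sum fun b => SM.sum fun c => ((((dgS hΩ hL d c b).add (dgS hΩ hL d b c)).sub
    (dgS hΩ hL b c d)).mul (SM.coord b)).mul (SM.coord c)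

lemma ginvS (hΩ : IsOpen Ω) (hL : SM Ω L) (hinv : ∀ p ∈ Ω, IsUnit (gmet L p.1 p.2).det)
    (a b : Fin m) : SM Ω (fun x v => ginv L x v a b) :=
  aux_inv_smooth (A := fun p : Vec m × Vec m => gmet L p.1 p.2)
    (fun i j => gS hΩ hL i j) hinv a b

lemma sprayS (hΩ : IsOpen Ω) (hL : SM Ω L) (hinv : ∀ p ∈ Ω, IsUnit (gmet L p.1 p.2).det)
    (a : Fin m) : SM Ω (spray L a) :=
  (SM.const (1/4)).mul (SM.sum fun d => (ginvS hΩ hL hinv a d).mul (lowS_S hΩ hL d))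

lemma sprayH (hΩ : IsOpen Ω) (hc : ∀ p ∈ Ω, ∀ s : ℝ, 0 < s → (p.1, s • p.2) ∈ Ω)
    (hL : SM Ω L) (hH : HM Ω 2 L) (a : Fin m) : HM Ω 2 (spray L a) := by
  rintro ⟨x, v⟩ hp t ht
  have h1 : ginv L x (t • v) = ginv L x v := by
    unfold ginv; congr 1; ext i j
    have := gH hΩ hc hL hH i j (x, v) hp t ht
    simpa using this
  have h2 : ∀ d, lowS L d x (t • v) = t ^ 2 * lowS L d x v := by
    intro d
    unfold lowS
    rw [Finset.mul_sum]
    refine Finset.sum_congr rfl fun b _ => ?_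
    rw [Finset.mul_sum]
    refine Finset.sum_congr rfl fun c _ => ?_
    have e : ∀ i j k, dg L i j k x (t • v) = dg L i j k x v := by
      intro i j k
      have := dgH hΩ hc hL hH i j k (x, v) hp t ht
      simpa using this
    simp only [e, Pi.smul_apply, smul_eq_mul]; ring
  simp only [spray_eq, h1, h2]
  simp only [Finset.mul_sum]
  refine Finset.sum_congr rfl fun d _ => by ring

lemma g_spray (hinv : ∀ p ∈ Ω, IsUnit (gmet L p.1 p.2).det) (d : Fin m) {x v : Vec m}
    (hp : (x, v) ∈ Ω) :
    ∑ a, gmet L x v d a * spray L a x v = (1/4) * lowS L d x v := by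
  have h1 : (gmet L x v) * ginv L x v = 1 := Matrix.mul_nonsing_inv _ (hinv _ hp)
  have h2 : Matrix.mulVec (gmet L x v) (Matrix.mulVec (ginv L x v) (fun e => lowS L e x v))
      = fun e => lowS L e x v := by
    rw [Matrix.mulVec_mulVec, h1, Matrix.one_mulVec]
  have h3 := congrFun h2 d
  rw [← h3]
  simp only [Matrix.mulVec, dotProduct, spray_eq]
  rw [Finset.mul_sum]
  refine Finset.sum_congr rfl fun a _ => by ring

lemma pdv_lowS (hΩ : IsOpen Ω) (hc : ∀ p ∈ Ω, ∀ s : ℝ, 0 < s → (p.1, s • p.2) ∈ Ω)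
    (hL : SM Ω L) (hH : HM Ω 2 L) (d μ : Fin m) {x v : Vec m} (hp : (x, v) ∈ Ω) :
    pdv (lowS L d) μ x v
      = 2 * ∑ b, (dg L d μ b x v + dg L d b μ x v - dg L μ b d x v) * v b := by
  have hT : ∀ b c, SM Ω (fun x v => dg L d c b x v + dg L d b c x v - dg L b c d x v) :=
    fun b c => ((dgS hΩ hL d c b).add (dgS hΩ hL d b c)).sub (dgS hΩ hL b c d)
  have h1 : pdv (lowS L d) μ x v = ∑ b, ∑ c,
      (((pdv (dg L d c b) μ x v + pdv (dg L d b c) μ x v - pdv (dg L b c d) μ x v) * v b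
        + (dg L d c b x v + dg L d b c x v - dg L b c d x v) * (if b = μ then 1 else 0)) * v c
        + (dg L d c b x v + dg L d b c x v - dg L b c d x v) * v b
          * (if c = μ then 1 else 0)) := by
    unfold lowS
    rw [pdv_sum hΩ (fun b => SM.sum fun c => ((hT b c).mul (SM.coord b)).mul (SM.coord c)) μ hp]
    refine Finset.sum_congr rfl fun b _ => ?_
    rw [pdv_sum hΩ (fun c => ((hT b c).mul (SM.coord b)).mul (SM.coord c)) μ hp]
    refine Finset.sum_congr rfl fun c _ => ?_
    rw [pdv_mul hΩ ((hT b c).mul (SM.coord b)) (SM.coord c) μ hp,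
      pdv_mul hΩ (hT b c) (SM.coord b) μ hp,
      pdv_sub hΩ ((dgS hΩ hL d c b).add (dgS hΩ hL d b c)) (dgS hΩ hL b c d) μ hp,
      pdv_add hΩ (dgS hΩ hL d c b) (dgS hΩ hL d b c) μ hp, pdv_coord, pdv_coord]
  have z1 : ∑ b, ∑ c, pdv (dg L d c b) μ x v * v b * v c = 0 := by
    refine Finset.sum_eq_zero fun b _ => ?_
    have := pdv_dg_v hΩ hc hL hH d b μ hp
    calc _ = v b * ∑ c, pdv (dg L d c b) μ x v * v c := by
          rw [Finset.mul_sum]; exact Finset.sum_congr rfl fun c _ => by ring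
      _ = 0 := by rw [this, mul_zero]
  have z2 : ∑ b, ∑ c, pdv (dg L d b c) μ x v * v b * v c = 0 := by
    rw [Finset.sum_comm, ← z1]
    exact Finset.sum_congr rfl fun b _ => Finset.sum_congr rfl fun c _ => by ring
  have z3 : ∑ b, ∑ c, pdv (dg L b c d) μ x v * v b * v c = 0 := by
    refine Finset.sum_eq_zero fun b _ => ?_
    have := pdv_dg_v hΩ hc hL hH b d μ hp
    calc _ = v b * ∑ c, pdv (dg L b c d) μ x v * v c := by
          rw [Finset.mul_sum]; exact Finset.sum_congr rfl fun c _ => by ring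
      _ = 0 := by rw [this, mul_zero]
  have h2 : pdv (lowS L d) μ x v
      = (∑ b, ∑ c, pdv (dg L d c b) μ x v * v b * v c)
      + (∑ b, ∑ c, pdv (dg L d b c) μ x v * v b * v c)
      - (∑ b, ∑ c, pdv (dg L b c d) μ x v * v b * v c)
      + (∑ b, ∑ c, (if b = μ then
          (dg L d c b x v + dg L d b c x v - dg L b c d x v) * v c else 0))
      + (∑ b, ∑ c, (if c = μ then
          (dg L d c b x v + dg L d b c x v - dg L b c d x v) * v b else 0)) := by
    rw [h1]
    simp only [← Finset.sum_add_distrib, ← Finset.sum_sub_distrib]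
    refine Finset.sum_congr rfl fun b _ => Finset.sum_congr rfl fun c _ => ?_
    split_ifs <;> ring
  rw [h2, z1, z2, z3]
  have w1 : (∑ b, ∑ c, (if b = μ then
      (dg L d c b x v + dg L d b c x v - dg L b c d x v) * v c else 0))
      = ∑ b, (dg L d μ b x v + dg L d b μ x v - dg L μ b d x v) * v b := by
    rw [Finset.sum_comm]
    refine Finset.sum_congr rfl fun c _ => ?_
    rw [Finset.sum_ite_eq' Finset.univ μ, if_pos (Finset.mem_univ _)]; ring
  have w2 : (∑ b, ∑ c, (if c = μ then
      (dg L d c b x v + dg L d b c x v - dg L b c d x v) * v b else 0))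
      = ∑ b, (dg L d μ b x v + dg L d b μ x v - dg L μ b d x v) * v b := by
    refine Finset.sum_congr rfl fun c _ => ?_
    rw [Finset.sum_ite_eq' Finset.univ μ, if_pos (Finset.mem_univ _),
      dg_symm hΩ hL c μ d hp]
  rw [w1, w2]; ring

/-- The lowered nonlinear connection. -/
lemma g_nConn (hΩ : IsOpen Ω) (hc : ∀ p ∈ Ω, ∀ s : ℝ, 0 < s → (p.1, s • p.2) ∈ Ω)
    (hL : SM Ω L) (hH : HM Ω 2 L) (hinv : ∀ p ∈ Ω, IsUnit (gmet L p.1 p.2).det)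
    (d μ : Fin m) {x v : Vec m} (hp : (x, v) ∈ Ω) :
    ∑ a, gmet L x v d a * nConn L a μ x v
      = (1/2) * (∑ b, (dg L d μ b x v + dg L d b μ x v - dg L μ b d x v) * v b)
        - ∑ a, cart L d a μ x v * spray L a x v := by
  have h1 := pdv_congr (F := fun x v => ∑ a, gmet L x v d a * spray L a x v)
    (H := fun x v => (1/4) * lowS L d x v) hΩ
    (fun p hp => g_spray hinv d (x := p.1) (v := p.2) hp) μ hp
  rw [pdv_sum hΩ (fun a => (gS hΩ hL d a).mul (sprayS hΩ hL hinv a)) μ hp,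
    pdv_mul hΩ (SM.const (1/4)) (lowS_S hΩ hL d) μ hp, pdv_const,
    pdv_lowS hΩ hc hL hH d μ hp] at h1
  have h2 : ∑ a, pdv (fun x v => gmet L x v d a * spray L a x v) μ x v
      = ∑ a, cart L d a μ x v * spray L a x v + ∑ a, gmet L x v d a * nConn L a μ x v := by
    rw [← Finset.sum_add_distrib]
    refine Finset.sum_congr rfl fun a _ => ?_
    rw [pdv_mul hΩ (gS hΩ hL d a) (sprayS hΩ hL hinv a) μ hp]; rfl
  rw [h2] at h1
  linarith

lemma nConnS (hΩ : IsOpen Ω) (hL : SM Ω L) (hinv : ∀ p ∈ Ω, IsUnit (gmet L p.1 p.2).det)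
    (a μ : Fin m) : SM Ω (nConn L a μ) := (sprayS hΩ hL hinv a).pdv hΩ μ

lemma nConn_v (hΩ : IsOpen Ω) (hc : ∀ p ∈ Ω, ∀ s : ℝ, 0 < s → (p.1, s • p.2) ∈ Ω)
    (hL : SM Ω L) (hH : HM Ω 2 L) (hinv : ∀ p ∈ Ω, IsUnit (gmet L p.1 p.2).det)
    (a : Fin m) {x v : Vec m} (hp : (x, v) ∈ Ω) :
    ∑ μ, nConn L a μ x v * v μ = 2 * spray L a x v := by
  have := euler hΩ (sprayS hΩ hL hinv a) (sprayH hΩ hc hL hH a) hp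
  exact_mod_cast this

lemma berw_v (hΩ : IsOpen Ω) (hc : ∀ p ∈ Ω, ∀ s : ℝ, 0 < s → (p.1, s • p.2) ∈ Ω)
    (hL : SM Ω L) (hH : HM Ω 2 L) (hinv : ∀ p ∈ Ω, IsUnit (gmet L p.1 p.2).det)
    (a μ : Fin m) {x v : Vec m} (hp : (x, v) ∈ Ω) :
    ∑ ν, pdv (nConn L a μ) ν x v * v ν = nConn L a μ x v := by
  have := euler hΩ (nConnS hΩ hL hinv a μ)
    (HM.pdv hΩ hc (sprayH hΩ hc hL hH a) (sprayS hΩ hL hinv a) μ) hp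
  rw [this]; simp

lemma berw_symm (hΩ : IsOpen Ω) (hL : SM Ω L)
    (hinv : ∀ p ∈ Ω, IsUnit (gmet L p.1 p.2).det)
    (a μ ν : Fin m) {x v : Vec m} (hp : (x, v) ∈ Ω) :
    pdv (nConn L a μ) ν x v = pdv (nConn L a ν) μ x v :=
  pdv_pdv_comm hΩ (sprayS hΩ hL hinv a) μ ν hp

end finsler

section pull
variable {Ω : Set (Vec m × Vec m)} {L : Vec m → Vec m → ℝ} {U : Set (Vec m)}
  {s : Vec m → Vec m} {f : Vec m → ℝ}

lemma s_diff (hU : IsOpen U) (hs : ContDiffOn ℝ (⊤ : ℕ∞) s U) {x : Vec m} (hx : x ∈ U) :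
    DifferentiableAt ℝ s x :=
  (hs.contDiffAt (hU.mem_nhds hx)).differentiableAt (by simp)

lemma gs_smooth (hΩ : IsOpen Ω) (hL : SM Ω L) (hs : ContDiffOn ℝ (⊤ : ℕ∞) s U)
    (hsΩ : ∀ x ∈ U, (x, s x) ∈ Ω) (a b : Fin m) :
    ContDiffOn ℝ (⊤ : ℕ∞) (fun y => gmet L y (s y) a b) U :=
  ContDiffOn.comp (g := fun p : Vec m × Vec m => gmet L p.1 p.2 a b)
    (f := fun y => (y, s y)) (gS hΩ hL a b) (contDiffOn_id.prodMk hs) hsΩ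

lemma christ_smooth (hΩ : IsOpen Ω) (hL : SM Ω L)
    (hinv : ∀ p ∈ Ω, IsUnit (gmet L p.1 p.2).det) (hU : IsOpen U)
    (hs : ContDiffOn ℝ (⊤ : ℕ∞) s U)
    (hsΩ : ∀ x ∈ U, (x, s x) ∈ Ω) (l a b : Fin m) :
    ContDiffOn ℝ (⊤ : ℕ∞) (fun y => christ (fun y => gmet L y (s y)) l a b y) U := by
  have hg := gs_smooth hΩ hL hs hsΩ
  have hd : ∀ i j k, ContDiffOn ℝ (⊤ : ℕ∞)
      (fun y => pdm (fun y => gmet L y (s y)) i j k y) U :=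
    fun i j k => aux_fderiv_apply_smooth hU (hg i j) (Pi.single k 1)
  have hi := aux_inv_smooth (A := fun y => gmet L y (s y)) hg (fun q hq => hinv _ (hsΩ q hq))
  unfold christ
  exact contDiffOn_const.mul (ContDiffOn.sum fun σ _ =>
    (hi l σ).mul (((hd _ _ _).add (hd _ _ _)).sub (hd _ _ _)))

lemma pdm_eq (hΩ : IsOpen Ω) (hL : SM Ω L) (hU : IsOpen U)
    (hs : ContDiffOn ℝ (⊤ : ℕ∞) s U) (hsΩ : ∀ x ∈ U, (x, s x) ∈ Ω) (a b c : Fin m)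
    {x : Vec m} (hx : x ∈ U) :
    pdm (fun y => gmet L y (s y)) a b c x
      = dg L a b c x (s x) + ∑ σ, cart L a b σ x (s x) * pde s σ c x :=
  chain hΩ (gS hΩ hL a b) (s_diff hU hs hx) (hsΩ x hx) c

lemma christ_symm (hΩ : IsOpen Ω) (hL : SM Ω L) (hU : IsOpen U)
    (hs : ContDiffOn ℝ (⊤ : ℕ∞) s U) (hsΩ : ∀ x ∈ U, (x, s x) ∈ Ω) (l a b : Fin m)
    {x : Vec m} (hx : x ∈ U) :
    christ (fun y => gmet L y (s y)) l a b x = christ (fun y => gmet L y (s y)) l b a x := by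
  unfold christ
  congr 1
  refine Finset.sum_congr rfl fun σ _ => ?_
  have : pdm (fun y => gmet L y (s y)) a b σ x = pdm (fun y => gmet L y (s y)) b a σ x := by
    rw [pdm_eq hΩ hL hU hs hsΩ a b σ hx, pdm_eq hΩ hL hU hs hsΩ b a σ hx,
      dg_symm hΩ hL a b σ (hsΩ x hx)]
    congr 1
    exact Finset.sum_congr rfl fun τ _ => by rw [cart12 hΩ hL a b τ (hsΩ x hx)]
  rw [this]; ring

lemma christ_s (hΩ : IsOpen Ω) (hc : ∀ p ∈ Ω, ∀ s : ℝ, 0 < s → (p.1, s • p.2) ∈ Ω)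
    (hL : SM Ω L) (hH : HM Ω 2 L) (hinv : ∀ p ∈ Ω, IsUnit (gmet L p.1 p.2).det)
    (hU : IsOpen U) (hs : ContDiffOn ℝ (⊤ : ℕ∞) s U) (hsΩ : ∀ x ∈ U, (x, s x) ∈ Ω)
    (hpre : ∀ x ∈ U, ∀ α, covD L s s x α = f x * s x α) (l μ : Fin m)
    {x : Vec m} (hx : x ∈ U) :
    ∑ ν, christ (fun y => gmet L y (s y)) l μ ν x * s x ν = nConn L l μ x (s x) := by
  have hp := hsΩ x hx
  have hgeo : ∀ ρ, ∑ ν, pde s ρ ν x * s x ν = f x * s x ρ - 2 * spray L ρ x (s x) := by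
    intro ρ
    rw [← hpre x hx ρ, ← nConn_v hΩ hc hL hH hinv ρ hp]
    unfold covD
    rw [← Finset.sum_sub_distrib]
    exact Finset.sum_congr rfl fun ν _ => by ring
  have zz : ∀ a c, ∑ ν, (∑ ρ, cart L a ν ρ x (s x) * pde s ρ c x) * s x ν = 0 := by
    intro a c
    simp only [Finset.sum_mul]
    rw [Finset.sum_comm]
    refine Finset.sum_eq_zero fun ρ _ => ?_
    calc _ = pde s ρ c x * ∑ ν, cart L a ν ρ x (s x) * s x ν := by
          rw [Finset.mul_sum]; exact Finset.sum_congr rfl fun ν _ => by ring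
      _ = 0 := by rw [cart_v2 hΩ hc hL hH a ρ hp, mul_zero]
  have hC : ∀ a, ∑ ν, (∑ ρ, cart L a μ ρ x (s x) * pde s ρ ν x) * s x ν
      = - 2 * ∑ ρ, cart L a ρ μ x (s x) * spray L ρ x (s x) := by
    intro a
    simp only [Finset.sum_mul]
    rw [Finset.sum_comm]
    have e1 : ∀ ρ, ∑ ν, cart L a μ ρ x (s x) * pde s ρ ν x * s x ν
        = f x * (cart L a μ ρ x (s x) * s x ρ)
          - 2 * (cart L a ρ μ x (s x) * spray L ρ x (s x)) := by
      intro ρ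
      rw [cart23 hΩ hL a ρ μ hp]
      calc _ = cart L a μ ρ x (s x) * ∑ ν, pde s ρ ν x * s x ν := by
            rw [Finset.mul_sum]; exact Finset.sum_congr rfl fun ν _ => by ring
        _ = _ := by rw [hgeo]; ring
    simp only [e1]
    rw [Finset.sum_sub_distrib, ← Finset.mul_sum, ← Finset.mul_sum,
      cart_v3 hΩ hc hL hH a μ hp]
    ring
  have hK : ∀ a, ∑ ν, (pdm (fun y => gmet L y (s y)) a ν μ x
      + pdm (fun y => gmet L y (s y)) a μ ν x
      - pdm (fun y => gmet L y (s y)) μ ν a x) * s x ν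
      = 2 * ∑ b, gmet L x (s x) a b * nConn L b μ x (s x) := by
    intro a
    rw [g_nConn hΩ hc hL hH hinv a μ hp]
    have : ∑ ν, (pdm (fun y => gmet L y (s y)) a ν μ x
      + pdm (fun y => gmet L y (s y)) a μ ν x
      - pdm (fun y => gmet L y (s y)) μ ν a x) * s x ν
      = (∑ b, (dg L a μ b x (s x) + dg L a b μ x (s x) - dg L μ b a x (s x)) * s x b)
        + ∑ ν, (∑ ρ, cart L a ν ρ x (s x) * pde s ρ μ x) * s x ν
        + ∑ ν, (∑ ρ, cart L a μ ρ x (s x) * pde s ρ ν x) * s x ν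
        - ∑ ν, (∑ ρ, cart L μ ν ρ x (s x) * pde s ρ a x) * s x ν := by
      rw [← Finset.sum_add_distrib, ← Finset.sum_add_distrib, ← Finset.sum_sub_distrib]
      refine Finset.sum_congr rfl fun ν _ => ?_
      rw [pdm_eq hΩ hL hU hs hsΩ a ν μ hx, pdm_eq hΩ hL hU hs hsΩ a μ ν hx,
        pdm_eq hΩ hL hU hs hsΩ μ ν a hx]
      ring
    rw [this, zz, zz, hC]; ring
  have h1 : ginv L x (s x) * gmet L x (s x) = 1 := Matrix.nonsing_inv_mul _ (hinv _ hp)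
  have h2 : Matrix.mulVec (ginv L x (s x))
      (Matrix.mulVec (gmet L x (s x)) (fun e => nConn L e μ x (s x)))
      = fun e => nConn L e μ x (s x) := by
    rw [Matrix.mulVec_mulVec, h1, Matrix.one_mulVec]
  have h3 := congrFun h2 l
  rw [← h3]
  simp only [Matrix.mulVec, dotProduct]
  unfold christ
  have h4 : ∀ a, ∑ b, gmet L x (s x) a b * nConn L b μ x (s x)
      = (1/2) * ∑ ν, (pdm (fun y => gmet L y (s y)) a ν μ x
      + pdm (fun y => gmet L y (s y)) a μ ν x
      - pdm (fun y => gmet L y (s y)) μ ν a x) * s x ν := by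
    intro a; rw [hK]; ring
  simp only [h4]
  simp only [Finset.mul_sum, Finset.sum_mul]
  rw [Finset.sum_comm]
  refine Finset.sum_congr rfl fun a _ => Finset.sum_congr rfl fun ν _ => ?_
  unfold ginv
  ring

lemma fderiv_christ_s (hΩ : IsOpen Ω)
    (hc : ∀ p ∈ Ω, ∀ s : ℝ, 0 < s → (p.1, s • p.2) ∈ Ω)
    (hL : SM Ω L) (hH : HM Ω 2 L) (hinv : ∀ p ∈ Ω, IsUnit (gmet L p.1 p.2).det)
    (hU : IsOpen U) (hs : ContDiffOn ℝ (⊤ : ℕ∞) s U) (hsΩ : ∀ x ∈ U, (x, s x) ∈ Ω)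
    (hpre : ∀ x ∈ U, ∀ α, covD L s s x α = f x * s x α) (l μ ρ : Fin m)
    {x : Vec m} (hx : x ∈ U) :
    ∑ ν, fderiv ℝ (fun y => christ (fun y => gmet L y (s y)) l ν ρ y) x (Pi.single μ 1) * s x ν
      = pdx (nConn L l ρ) μ x (s x) + ∑ σ, pdv (nConn L l ρ) σ x (s x) * pde s σ μ x
        - ∑ σ, christ (fun y => gmet L y (s y)) l σ ρ x * pde s σ μ x := by
  rw [← chain hΩ (nConnS hΩ hL hinv l ρ) (s_diff hU hs hx) (hsΩ x hx) μ]
  have e : (fun y => nConn L l ρ y (s y)) =ᶠ[nhds x]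
      (fun y => ∑ ν, christ (fun y => gmet L y (s y)) l ν ρ y * s y ν) := by
    filter_upwards [hU.mem_nhds hx] with y hy
    rw [← christ_s hΩ hc hL hH hinv hU hs hsΩ hpre l ρ hy]
    exact Finset.sum_congr rfl fun ν _ => by rw [christ_symm hΩ hL hU hs hsΩ l ρ ν hy]
  rw [e.fderiv_eq]
  have hd : ∀ ν, HasFDerivAt (fun y => christ (fun y => gmet L y (s y)) l ν ρ y * s y ν) _ x :=
    fun ν => (aux_diffAt hU (christ_smooth hΩ hL hinv hU hs hsΩ l ν ρ) hx).hasFDerivAt.mul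
      ((differentiableAt_pi.1 (s_diff hU hs hx) ν).hasFDerivAt)
  rw [(HasFDerivAt.fun_sum (u := Finset.univ) (fun ν _ => hd ν)).fderiv]
  rw [ContinuousLinearMap.sum_apply, ← Finset.sum_sub_distrib]
  refine Finset.sum_congr rfl fun ν _ => ?_
  simp only [ContinuousLinearMap.add_apply, ContinuousLinearMap.smul_apply, smul_eq_mul, pde]
  ring

lemma main_contr (hΩ : IsOpen Ω)
    (hc : ∀ p ∈ Ω, ∀ s : ℝ, 0 < s → (p.1, s • p.2) ∈ Ω)
    (hL : SM Ω L) (hH : HM Ω 2 L) (hinv : ∀ p ∈ Ω, IsUnit (gmet L p.1 p.2).det)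
    (hU : IsOpen U) (hs : ContDiffOn ℝ (⊤ : ℕ∞) s U) (hsΩ : ∀ x ∈ U, (x, s x) ∈ Ω)
    (hpre : ∀ x ∈ U, ∀ α, covD L s s x α = f x * s x α) (l μ : Fin m)
    {x : Vec m} (hx : x ∈ U) :
    ∑ ρ, (∑ ν, riem (fun y => gmet L y (s y)) l ν μ ρ x * s x ν) * s x ρ
      = ∑ ρ, curv (nConn L) l μ ρ x (s x) * s x ρ := by
  have hp := hsΩ x hx
  have K1 := fun a b => christ_s hΩ hc hL hH hinv hU hs hsΩ hpre a b hx
  have K2 : ∀ a b, ∑ ν, christ (fun y => gmet L y (s y)) a ν b x * s x ν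
      = nConn L a b x (s x) := by
    intro a b
    rw [← K1 a b]
    exact Finset.sum_congr rfl fun ν _ => by rw [christ_symm hΩ hL hU hs hsΩ a b ν hx]
  have hd := fun b c => fderiv_christ_s hΩ hc hL hH hinv hU hs hsΩ hpre l b c hx
  set Γ := fun a b c => christ (fun y => gmet L y (s y)) a b c x with hΓ
  have step : ∀ ρ, ∑ ν, riem (fun y => gmet L y (s y)) l ν μ ρ x * s x ν
      = curv (nConn L) l μ ρ x (s x)
        + ∑ σ, (pdv (nConn L l ρ) σ x (s x) - Γ l σ ρ) * (pde s σ μ x + nConn L σ μ x (s x))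
        - ∑ σ, (pdv (nConn L l μ) σ x (s x) - Γ l σ μ)
            * (pde s σ ρ x + nConn L σ ρ x (s x)) := by
    intro ρ
    have q : ∀ b c, ∑ ν, (∑ σ, Γ l σ b * Γ σ ν c) * s x ν
        = ∑ σ, Γ l σ b * nConn L σ c x (s x) := by
      intro b c
      simp only [Finset.sum_mul]
      rw [Finset.sum_comm]
      refine Finset.sum_congr rfl fun σ _ => ?_
      rw [← K2 σ c, Finset.mul_sum]
      exact Finset.sum_congr rfl fun ν _ => by simp only [hΓ]; ring
    have r1 : ∑ ν, riem (fun y => gmet L y (s y)) l ν μ ρ x * s x ν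
        = (∑ ν, fderiv ℝ (fun y => christ (fun y => gmet L y (s y)) l ν ρ y) x
              (Pi.single μ 1) * s x ν)
          - (∑ ν, fderiv ℝ (fun y => christ (fun y => gmet L y (s y)) l ν μ y) x
              (Pi.single ρ 1) * s x ν)
          + (∑ ν, (∑ σ, Γ l σ μ * Γ σ ν ρ) * s x ν)
          - ∑ ν, (∑ σ, Γ l σ ρ * Γ σ ν μ) * s x ν := by
      rw [← Finset.sum_sub_distrib, ← Finset.sum_add_distrib, ← Finset.sum_sub_distrib]
      refine Finset.sum_congr rfl fun ν _ => ?_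
      simp only [riem, hΓ]; ring
    rw [r1, hd, hd, q, q]
    unfold curv hderiv
    have comm : ∀ b c, ∑ ν, nConn L ν c x (s x) * pdv (nConn L l b) ν x (s x)
        = ∑ σ, pdv (nConn L l b) σ x (s x) * nConn L σ c x (s x) :=
      fun b c => Finset.sum_congr rfl fun ν _ => mul_comm _ _
    rw [comm, comm]
    simp only [sub_mul, mul_add, Finset.sum_add_distrib, Finset.sum_sub_distrib]
    simp only [hΓ]
    ring
  have hD : ∀ σ, ∑ ρ, (pde s σ ρ x + nConn L σ ρ x (s x)) * s x ρ = f x * s x σ :=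
    fun σ => hpre x hx σ
  have v1 : ∑ ρ, (∑ σ, (pdv (nConn L l ρ) σ x (s x) - Γ l σ ρ)
      * (pde s σ μ x + nConn L σ μ x (s x))) * s x ρ = 0 := by
    simp only [Finset.sum_mul]
    rw [Finset.sum_comm]
    refine Finset.sum_eq_zero fun σ _ => ?_
    calc _ = (pde s σ μ x + nConn L σ μ x (s x))
          * ((∑ ρ, pdv (nConn L l σ) ρ x (s x) * s x ρ) - ∑ ρ, Γ l σ ρ * s x ρ) := by
          rw [← Finset.sum_sub_distrib, Finset.mul_sum]
          refine Finset.sum_congr rfl fun ρ _ => ?_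
          rw [berw_symm hΩ hL hinv l σ ρ hp]; ring
      _ = 0 := by rw [berw_v hΩ hc hL hH hinv l σ hp, K1 l σ]; ring
  have v2 : ∑ ρ, (∑ σ, (pdv (nConn L l μ) σ x (s x) - Γ l σ μ)
      * (pde s σ ρ x + nConn L σ ρ x (s x))) * s x ρ = 0 := by
    simp only [Finset.sum_mul]
    rw [Finset.sum_comm]
    calc _ = ∑ σ, (pdv (nConn L l μ) σ x (s x) - Γ l σ μ) * (f x * s x σ) := by
          refine Finset.sum_congr rfl fun σ _ => ?_
          rw [← hD σ, Finset.mul_sum]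
          exact Finset.sum_congr rfl fun ρ _ => by ring
      _ = f x * ((∑ σ, pdv (nConn L l μ) σ x (s x) * s x σ) - ∑ σ, Γ l σ μ * s x σ) := by
          rw [← Finset.sum_sub_distrib, Finset.mul_sum]
          exact Finset.sum_congr rfl fun σ _ => by ring
      _ = 0 := by rw [berw_v hΩ hc hL hH hinv l μ hp, K2 l μ]; ring
  simp only [step, sub_mul, add_mul]
  rw [Finset.sum_sub_distrib, Finset.sum_add_distrib]
  simp only [← sub_mul, ← add_mul]
  rw [v1, v2]; ring

end pull

/-- Corollary (pseudo-Riemannian characterization of the curvature endomorphism):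
if `s` is pregeodesic then `R_s(X) = R^{g_s}(X,s)s` and
`Ric(s(x)) = Ric^{g_s}_{νρ} s^ν s^ρ`. -/
theorem statement9 {m : ℕ} (hm : 2 ≤ m)
    (Ω : Set (Vec m × Vec m)) (hΩopen : IsOpen Ω) (hΩne : Ω.Nonempty)
    (hΩslit : ∀ p ∈ Ω, p.2 ≠ 0)
    (hΩcone : ∀ p ∈ Ω, ∀ s : ℝ, 0 < s → (p.1, s • p.2) ∈ Ω)
    (L : Vec m → Vec m → ℝ)
    (hLsmooth : ContDiffOn ℝ (⊤ : ℕ∞) (fun p : Vec m × Vec m => L p.1 p.2) Ω)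
    (hLhom : ∀ p ∈ Ω, ∀ s : ℝ, 0 < s → L p.1 (s • p.2) = s ^ 2 * L p.1 p.2)
    (hLinv : ∀ p ∈ Ω, IsUnit (gmet L p.1 p.2).det)
    (U : Set (Vec m)) (hUopen : IsOpen U)
    (s : Vec m → Vec m) (hssmooth : ContDiffOn ℝ (⊤ : ℕ∞) s U)
    (hsΩ : ∀ x ∈ U, (x, s x) ∈ Ω)
    (f : Vec m → ℝ) (hfsmooth : ContDiffOn ℝ (⊤ : ℕ∞) f U)
    (hpregeo : ∀ x ∈ U, ∀ α, covD L s s x α = f x * s x α) :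
    ∀ x ∈ U,
      (∀ (X : Vec m) (lam : Fin m),
        ∑ β, ∑ μ, curv (nConn L) lam β μ x (s x) * X β * s x μ
          = ∑ ν, ∑ μ, ∑ ρ, riem (fun y => gmet L y (s y)) lam ν μ ρ x
              * s x ν * X μ * s x ρ)
      ∧ ricciScalar (nConn L) x (s x)
          = ∑ ν, ∑ ρ, ricciPull (fun y => gmet L y (s y)) ν ρ x * s x ν * s x ρ := by
  intro x hx
  have hM := fun l μ => main_contr (f := f) hΩopen hΩcone hLsmooth hLhom hLinv hUopen hssmooth
    hsΩ hpregeo l μ hx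
  constructor
  · intro X lam
    have e1 : ∑ β, ∑ μ, curv (nConn L) lam β μ x (s x) * X β * s x μ
        = ∑ β, X β * ∑ μ, curv (nConn L) lam β μ x (s x) * s x μ := by
      refine Finset.sum_congr rfl fun β _ => ?_
      rw [Finset.mul_sum]
      exact Finset.sum_congr rfl fun μ _ => by ring
    rw [e1, Finset.sum_comm]
    refine Finset.sum_congr rfl fun β _ => ?_
    rw [← hM lam β, Finset.mul_sum, Finset.sum_comm]
    refine Finset.sum_congr rfl fun ρ _ => ?_
    rw [Finset.sum_mul, Finset.mul_sum]
    exact Finset.sum_congr rfl fun ν _ => by ring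
  · unfold ricciScalar ricciPull
    simp only [Finset.sum_mul]
    rw [Finset.sum_comm]
    have e2 : ∀ μ, ∑ α, curv (nConn L) μ μ α x (s x) * s x α
        = ∑ ν, ∑ ρ, riem (fun y => gmet L y (s y)) μ ν μ ρ x * s x ν * s x ρ := by
      intro μ
      rw [← hM μ μ, Finset.sum_comm]
      exact Finset.sum_congr rfl fun ρ _ => by rw [Finset.sum_mul]
    simp only [e2]
    rw [Finset.sum_comm]
    refine Finset.sum_congr rfl fun ν _ => ?_
    rw [Finset.sum_comm]
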